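/- arXiv:2506.03568 — 2 statements merged into one kernel-verified Lean document; each statement's English description precedes it below -/
import Mathlib

section
/- In a finite discounted MDP, let π^g and π^r be stationary policies, T_c : S → {0,1} an intervention function, and π^b(a|s) = T_c(s)·π^g(a|s) + (1−T_c(s))·π^r(a|s) the behavior policy. Then the return difference between the behavior policy and the human-guided policy decomposes as J(π^b) − J(π^g) = (1/(1−γ)) · Σ_s d_{π^b}(s) · (1−T_c(s)) · (Σ_a π^r(a|s) Q^{π^g}(s,a) − V^{π^g}(s)), where d_{π^b} is the normalized discounted state visitation distribution of π^b. -/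
open scoped BigOperators

/-- The state distribution at time `t` induced by starting from `ρ` and following
policy `π` in an MDP with transition function `P`. -/
noncomputable def stateDist {S A : Type*} [Fintype S] [Fintype A]
    (P : S → A → S → ℝ) (π : S → A → ℝ) (ρ : S → ℝ) : ℕ → S → ℝ
  | 0 => ρ
  | t + 1 => fun s' => ∑ s : S, ∑ a : A, stateDist P π ρ t s * π s a * P s a s'

/-- The normalized discounted state visitation distribution
`d_π(s) = (1-γ) ∑_{t≥0} γ^t Pr(s_t = s)`. -/
noncomputable def dvisit {S A : Type*} [Fintype S] [Fintype A]
    (γ : ℝ) (P : S → A → S → ℝ) (π : S → A → ℝ) (ρ : S → ℝ) (s : S) : ℝ :=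
  (1 - γ) * ∑' t : ℕ, γ ^ t * stateDist P π ρ t s

section Occupancy

variable {S A : Type*} [Fintype S] [Fintype A] {P : S → A → S → ℝ} {π : S → A → ℝ} {ρ : S → ℝ}

theorem stateDist_nonneg (hP0 : ∀ s a s', 0 ≤ P s a s') (hπ0 : ∀ s a, 0 ≤ π s a)
    (hρ0 : ∀ s, 0 ≤ ρ s) (t : ℕ) (s : S) : 0 ≤ stateDist P π ρ t s := by
  induction t generalizing s with
  | zero => exact hρ0 s
  | succ t ih =>
    exact Finset.sum_nonneg fun x _ => Finset.sum_nonneg fun a _ =>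
      mul_nonneg (mul_nonneg (ih x) (hπ0 x a)) (hP0 x a s)

theorem sum_stateDist (hP1 : ∀ s a, ∑ s', P s a s' = 1) (hπ1 : ∀ s, ∑ a, π s a = 1)
    (hρ1 : ∑ s, ρ s = 1) (t : ℕ) : ∑ s, stateDist P π ρ t s = 1 := by
  induction t with
  | zero => exact hρ1
  | succ t ih =>
    simp only [stateDist]
    rw [Finset.sum_comm]
    refine Eq.trans (Finset.sum_congr rfl fun x _ => ?_) ih
    rw [Finset.sum_comm]
    simp only [← Finset.mul_sum, hP1, hπ1, mul_one]

theorem summable_discounted_stateDist {γ : ℝ} (hγ0 : 0 ≤ γ) (hγ1 : γ < 1)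
    (hP0 : ∀ s a s', 0 ≤ P s a s') (hP1 : ∀ s a, ∑ s', P s a s' = 1)
    (hπ0 : ∀ s a, 0 ≤ π s a) (hπ1 : ∀ s, ∑ a, π s a = 1)
    (hρ0 : ∀ s, 0 ≤ ρ s) (hρ1 : ∑ s, ρ s = 1) (s : S) :
    Summable fun t : ℕ => γ ^ t * stateDist P π ρ t s := by
  have h0 := stateDist_nonneg hP0 hπ0 hρ0
  refine Summable.of_nonneg_of_le (fun t => mul_nonneg (pow_nonneg hγ0 t) (h0 t s))
    (fun t => ?_) (summable_geometric_of_lt_one hγ0 hγ1)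
  refine mul_le_of_le_one_right (pow_nonneg hγ0 t) ?_
  rw [← sum_stateDist hP1 hπ1 hρ1 t]
  exact Finset.single_le_sum (fun x _ => h0 t x) (Finset.mem_univ s)

/-- The Bellman flow equation for the unnormalized discounted occupancy measure. -/
theorem tsum_discounted_stateDist_eq {γ : ℝ}
    (hs : ∀ s, Summable fun t : ℕ => γ ^ t * stateDist P π ρ t s) (s' : S) :
    ∑' t : ℕ, γ ^ t * stateDist P π ρ t s' =
      ρ s' + γ * ∑ s, ∑ a, (∑' t : ℕ, γ ^ t * stateDist P π ρ t s) * (π s a * P s a s') := by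
  have key : HasSum (fun t : ℕ => γ ^ (t + 1) * stateDist P π ρ (t + 1) s')
      (γ * ∑ s, ∑ a, (∑' t : ℕ, γ ^ t * stateDist P π ρ t s) * (π s a * P s a s')) := by
    have h := (hasSum_sum fun s (_ : s ∈ Finset.univ) =>
      hasSum_sum fun a (_ : a ∈ Finset.univ) =>
        (hs s).hasSum.mul_right (π s a * P s a s')).mul_left γ
    refine h.congr_fun fun t => ?_
    simp only [stateDist, Finset.mul_sum]
    exact Finset.sum_congr rfl fun s _ => Finset.sum_congr rfl fun a _ => by ring
  rw [(hs s').tsum_eq_zero_add, key.tsum_eq]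
  simp [stateDist]

/-- A function solving the Bellman evaluation equation with reward `g` has `ρ`-average equal to
the occupancy-weighted total of `g`. -/
theorem sum_mul_eq_sum_tsum_mul {γ : ℝ}
    (hs : ∀ s, Summable fun t : ℕ => γ ^ t * stateDist P π ρ t s) {D g : S → ℝ}
    (hD : ∀ s, D s = g s + γ * ∑ a, π s a * ∑ s', P s a s' * D s') :
    ∑ s, ρ s * D s = ∑ s, (∑' t : ℕ, γ ^ t * stateDist P π ρ t s) * g s := by
  have hN := tsum_discounted_stateDist_eq hs
  set N : S → ℝ := fun s => ∑' t : ℕ, γ ^ t * stateDist P π ρ t s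
  have hg : ∀ s, N s * g s = N s * D s - γ * ∑ a, ∑ s', N s * (π s a * P s a s') * D s' := by
    intro s
    have h : ∑ a, ∑ s', N s * (π s a * P s a s') * D s' =
        N s * ∑ a, π s a * ∑ s', P s a s' * D s' := by
      simp only [Finset.mul_sum]
      exact Finset.sum_congr rfl fun a _ => Finset.sum_congr rfl fun s' _ => by ring
    rw [h]
    linear_combination (-N s) * hD s
  have hρ : ∀ s', ρ s' * D s' =
      N s' * D s' - γ * ∑ s, ∑ a, N s * (π s a * P s a s') * D s' := by
    intro s'
    have h : ∑ s, ∑ a, N s * (π s a * P s a s') * D s' =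
        (∑ s, ∑ a, N s * (π s a * P s a s')) * D s' := by
      simp only [Finset.sum_mul]
    rw [h]
    linear_combination (-D s') * hN s'
  change _ = ∑ s, N s * g s
  simp only [hg, hρ, Finset.sum_sub_distrib, ← Finset.mul_sum]
  congr 2
  rw [Finset.sum_comm]
  exact Finset.sum_congr rfl fun s _ => Finset.sum_comm

end Occupancy

/-- **Return-difference decomposition for shared control.**  With behavior policy
`π^b(a|s) = T_c(s) π^g(a|s) + (1−T_c(s)) π^r(a|s)` for an intervention function
`T_c : S → {0,1}`, we have
`J(π^b) − J(π^g) = (1/(1−γ)) ∑_s d_{π^b}(s) (1−T_c(s)) (∑_a π^r(a|s) Q^{π^g}(s,a) − V^{π^g}(s))`. -/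
theorem shared_control_return_decomposition
    {S A : Type*} [Fintype S] [Fintype A] [Nonempty S] [Nonempty A]
    (P : S → A → S → ℝ) (r : S → A → ℝ) (γ : ℝ) (ρ : S → ℝ)
    (hγ0 : 0 ≤ γ) (hγ1 : γ < 1)
    (hP0 : ∀ s a s', 0 ≤ P s a s') (hP1 : ∀ s a, ∑ s', P s a s' = 1)
    (hρ0 : ∀ s, 0 ≤ ρ s) (hρ1 : ∑ s, ρ s = 1)
    (πg πr : S → A → ℝ)
    (hπg0 : ∀ s a, 0 ≤ πg s a) (hπg1 : ∀ s, ∑ a, πg s a = 1)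
    (hπr0 : ∀ s a, 0 ≤ πr s a) (hπr1 : ∀ s, ∑ a, πr s a = 1)
    (Tc : S → ℝ) (hTc : ∀ s, Tc s = 0 ∨ Tc s = 1)
    (πb : S → A → ℝ)
    (hπb : ∀ s a, πb s a = Tc s * πg s a + (1 - Tc s) * πr s a)
    (Qg : S → A → ℝ) (Vg : S → ℝ)
    (hQg : ∀ s a, Qg s a = r s a + γ * ∑ s', P s a s' * Vg s')
    (hVg : ∀ s, Vg s = ∑ a, πg s a * Qg s a)
    (Qb : S → A → ℝ) (Vb : S → ℝ)
    (hQb : ∀ s a, Qb s a = r s a + γ * ∑ s', P s a s' * Vb s')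
    (hVb : ∀ s, Vb s = ∑ a, πb s a * Qb s a) :
    (∑ s, ρ s * Vb s) - (∑ s, ρ s * Vg s)
      = (1 / (1 - γ)) *
        ∑ s, dvisit γ P πb ρ s *
          ((1 - Tc s) * ((∑ a, πr s a * Qg s a) - Vg s)) := by
  have hTc0 : ∀ s, 0 ≤ Tc s := fun s => by rcases hTc s with h | h <;> simp [h]
  have hTc1 : ∀ s, 0 ≤ 1 - Tc s := fun s => by rcases hTc s with h | h <;> simp [h]
  have hπb0 : ∀ s a, 0 ≤ πb s a := fun s a => by
    rw [hπb]
    exact add_nonneg (mul_nonneg (hTc0 s) (hπg0 s a)) (mul_nonneg (hTc1 s) (hπr0 s a))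
  have hπb1 : ∀ s, ∑ a, πb s a = 1 := fun s => by
    simp only [hπb, Finset.sum_add_distrib, ← Finset.mul_sum, hπg1, hπr1]
    ring
  have hQ : ∀ s a, Qb s a = Qg s a + γ * ∑ s', P s a s' * (Vb s' - Vg s') := fun s a => by
    simp only [hQb, hQg, mul_sub, Finset.sum_sub_distrib]
    ring
  have hD : ∀ s, Vb s - Vg s = (1 - Tc s) * ((∑ a, πr s a * Qg s a) - Vg s) +
      γ * ∑ a, πb s a * ∑ s', P s a s' * (Vb s' - Vg s') := fun s => by
    have h₁ : ∑ a, πb s a * Qb s a = ∑ a, πb s a * Qg s a +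
        γ * ∑ a, πb s a * ∑ s', P s a s' * (Vb s' - Vg s') := by
      rw [Finset.mul_sum, ← Finset.sum_add_distrib]
      exact Finset.sum_congr rfl fun a _ => by rw [hQ]; ring
    have h₂ : ∑ a, πb s a * Qg s a =
        Tc s * ∑ a, πg s a * Qg s a + (1 - Tc s) * ∑ a, πr s a * Qg s a := by
      rw [Finset.mul_sum, Finset.mul_sum, ← Finset.sum_add_distrib]
      exact Finset.sum_congr rfl fun a _ => by rw [hπb]; ring
    linear_combination hVb s + h₁ + h₂ - Tc s * hVg s
  have hγ : 1 - γ ≠ 0 := (sub_pos.mpr hγ1).ne'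
  rw [← Finset.sum_sub_distrib]
  simp only [← mul_sub]
  rw [sum_mul_eq_sum_tsum_mul
    (summable_discounted_stateDist hγ0 hγ1 hP0 hP1 hπb0 hπb1 hρ0 hρ1) hD, Finset.mul_sum]
  refine Finset.sum_congr rfl fun s _ => ?_
  rw [dvisit]
  field_simp
end

section
/- (Theorem 1, performance guarantee of confidence-guided shared control.) In a finite discounted MDP, let π^g (human-guided policy) and π^r (self-learning policy) be stationary policies, T_c : S → {0,1} the confidence-based intervention function, and π^b(a|s) = T_c(s)·π^g(a|s) + (1−T_c(s))·π^r(a|s) the behavior policy. Let δ ∈ (0, 1/2], let t ∈ ℝ satisfy Φ(t) = 1−δ where Φ is the standard normal CDF, and let σ_g, σ_r : S → ℝ be value-distribution standard deviations with σ_g(s)² ≤ σ_max² and σ_r(s)² ≤ σ_max² for all s (bounded-variance assumption). Suppose that for every state s at which the self-learning policy is executed (T_c(s) = 0), the expected advantage satisfies Σ_a π^r(a|s) Q^{π^g}(s,a) − V^{π^g}(s) ≥ −√(σ_r(s)² + σ_g(s)²) · t. Then the return of the behavior policy is guaranteed to be no worse than J(π^b) ≥ J(π^g) − (√2 · σ_max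 · t)/(1−γ). -/
open scoped BigOperators

/-- The standard Gaussian CDF is below `1/2` on the negative half-line. -/
theorem cdf_gaussianReal_lt_half {t : ℝ} (ht : t < 0) :
    ProbabilityTheory.cdf (ProbabilityTheory.gaussianReal 0 1) t < 1 / 2 := by
  set μ := ProbabilityTheory.gaussianReal 0 1
  rw [ProbabilityTheory.cdf_eq_real]
  have hsymm : μ.real (Set.Ici (-t)) = μ.real (Set.Iic t) := by
    have hmap : μ.map (fun x : ℝ => -x) = μ := by
      simpa using ProbabilityTheory.gaussianReal_map_neg (μ := 0) (v := 1)
    conv_lhs => rw [← hmap]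
    rw [MeasureTheory.map_measureReal_apply measurable_neg measurableSet_Ici]
    congr 1
    ext x
    simp
  have hpos : 0 < μ.real (Set.Ioo t (-t)) := by
    rw [MeasureTheory.measureReal_def, ENNReal.toReal_pos_iff]
    refine ⟨pos_iff_ne_zero.2 fun h => ?_, MeasureTheory.measure_lt_top _ _⟩
    have h' := ProbabilityTheory.gaussianReal_absolutelyContinuous' 0 one_ne_zero h
    rw [Real.volume_Ioo, ENNReal.ofReal_eq_zero] at h'
    linarith
  have hIio : μ.real (Set.Iic t) + μ.real (Set.Ioo t (-t)) = μ.real (Set.Iio (-t)) := by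
    have hdisj : Disjoint (Set.Iic t) (Set.Ioo t (-t)) :=
      Set.disjoint_left.2 fun x hx hx' => not_lt.2 hx hx'.1
    rw [← MeasureTheory.measureReal_union hdisj measurableSet_Ioo,
      Set.Iic_union_Ioo_eq_Iio (by linarith)]
  have hcompl := MeasureTheory.probReal_add_probReal_compl (μ := μ)
    (measurableSet_Iio (a := -t))
  rw [Set.compl_Iio] at hcompl
  linarith

/-- An average is at most any upper bound of the averaged function. -/
theorem sum_mul_le_of_sum_eq_one {ι : Type*} [Fintype ι] {w f : ι → ℝ} {M : ℝ}
    (hw0 : ∀ i, 0 ≤ w i) (hw1 : ∑ i, w i = 1) (hf : ∀ i, f i ≤ M) :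
    ∑ i, w i * f i ≤ M :=
  calc ∑ i, w i * f i ≤ ∑ i, w i * M :=
        Finset.sum_le_sum fun i _ => mul_le_mul_of_nonneg_left (hf i) (hw0 i)
    _ = M := by rw [← Finset.sum_mul, hw1, one_mul]

/-- If the one-step advantage of a policy `π` over a value function `V` is everywhere at least
`-c`, then the value function `W` of `π` is at least `V - c / (1 - γ)`. -/
theorem value_sub_le_of_advantage_ge {S A : Type*} [Fintype S] [Fintype A]
    {P : S → A → S → ℝ} {r : S → A → ℝ} {γ c : ℝ} (hγ0 : 0 ≤ γ) (hγ1 : γ < 1)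
    (hP0 : ∀ s a s', 0 ≤ P s a s') (hP1 : ∀ s a, ∑ s', P s a s' = 1)
    {π : S → A → ℝ} (hπ0 : ∀ s a, 0 ≤ π s a) (hπ1 : ∀ s, ∑ a, π s a = 1)
    {V W : S → ℝ}
    (hW : ∀ s, W s = ∑ a, π s a * (r s a + γ * ∑ s', P s a s' * W s'))
    (hadv : ∀ s, V s - c ≤ ∑ a, π s a * (r s a + γ * ∑ s', P s a s' * V s')) (s : S) :
    V s - W s ≤ c / (1 - γ) := by
  have : Nonempty S := ⟨s⟩
  obtain ⟨m, hm⟩ := Finite.exists_max fun s => V s - W s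
  refine (hm s).trans ?_
  have hstep : ∑ a, π m a * (γ * ∑ s', P m a s' * (V s' - W s')) ≤ γ * (V m - W m) :=
    sum_mul_le_of_sum_eq_one (hπ0 m) (hπ1 m) fun a =>
      mul_le_mul_of_nonneg_left (sum_mul_le_of_sum_eq_one (hP0 m a) (hP1 m a) hm) hγ0
  have hdiff : ∑ a, π m a * (γ * ∑ s', P m a s' * (V s' - W s')) =
      (∑ a, π m a * (r m a + γ * ∑ s', P m a s' * V s')) - W m := by
    rw [hW m, ← Finset.sum_sub_distrib]
    refine Finset.sum_congr rfl fun a _ => ?_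
    simp only [mul_sub, Finset.sum_sub_distrib]
    ring
  rw [le_div_iff₀ (by linarith)]
  linarith [hadv m]

/-- **Theorem 1 (performance guarantee of confidence-guided shared control).**
In a finite discounted MDP with human-guided policy `π^g`, self-learning policy
`π^r`, confidence-based intervention function `T_c : S → {0,1}` and behavior
policy `π^b(a|s) = T_c(s) π^g(a|s) + (1−T_c(s)) π^r(a|s)`, where `δ ∈ (0,1/2]`,
`Φ(t) = 1−δ` for the standard normal CDF `Φ`, the value-distribution standard
deviations satisfy `σ_g(s)² ≤ σ_max²`, `σ_r(s)² ≤ σ_max²`, and at every state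
where the self-learning policy is executed the expected advantage satisfies
`∑_a π^r(a|s) Q^{π^g}(s,a) − V^{π^g}(s) ≥ −√(σ_r(s)² + σ_g(s)²)·t`, the return
of the behavior policy satisfies `J(π^b) ≥ J(π^g) − √2·σ_max·t/(1−γ)`. -/
theorem confidence_guided_shared_control_performance
    {S A : Type*} [Fintype S] [Fintype A] [Nonempty S] [Nonempty A]
    (P : S → A → S → ℝ) (r : S → A → ℝ) (γ : ℝ) (ρ : S → ℝ)
    (hγ0 : 0 ≤ γ) (hγ1 : γ < 1)
    (hP0 : ∀ s a s', 0 ≤ P s a s') (hP1 : ∀ s a, ∑ s', P s a s' = 1)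
    (hρ0 : ∀ s, 0 ≤ ρ s) (hρ1 : ∑ s, ρ s = 1)
    (πg πr : S → A → ℝ)
    (hπg0 : ∀ s a, 0 ≤ πg s a) (hπg1 : ∀ s, ∑ a, πg s a = 1)
    (hπr0 : ∀ s a, 0 ≤ πr s a) (hπr1 : ∀ s, ∑ a, πr s a = 1)
    (Tc : S → ℝ) (hTc : ∀ s, Tc s = 0 ∨ Tc s = 1)
    (πb : S → A → ℝ)
    (hπb : ∀ s a, πb s a = Tc s * πg s a + (1 - Tc s) * πr s a)
    (Qg : S → A → ℝ) (Vg : S → ℝ)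
    (hQg : ∀ s a, Qg s a = r s a + γ * ∑ s', P s a s' * Vg s')
    (hVg : ∀ s, Vg s = ∑ a, πg s a * Qg s a)
    (Qb : S → A → ℝ) (Vb : S → ℝ)
    (hQb : ∀ s a, Qb s a = r s a + γ * ∑ s', P s a s' * Vb s')
    (hVb : ∀ s, Vb s = ∑ a, πb s a * Qb s a)
    (δ : ℝ) (hδ0 : 0 < δ) (hδ1 : δ ≤ 1 / 2)
    (t : ℝ)
    (ht : ProbabilityTheory.cdf (ProbabilityTheory.gaussianReal 0 1) t = 1 - δ)
    (σg σr : S → ℝ) (σmax : ℝ) (hσmax : 0 ≤ σmax)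
    (hσg : ∀ s, σg s ^ 2 ≤ σmax ^ 2) (hσr : ∀ s, σr s ^ 2 ≤ σmax ^ 2)
    (hadv : ∀ s, Tc s = 0 →
      (∑ a, πr s a * Qg s a) - Vg s ≥ -(Real.sqrt (σr s ^ 2 + σg s ^ 2) * t)) :
    (∑ s, ρ s * Vb s)
      ≥ (∑ s, ρ s * Vg s) - Real.sqrt 2 * σmax * t / (1 - γ) := by
  have ht0 : 0 ≤ t := by
    by_contra! h
    linarith [cdf_gaussianReal_lt_half h]
  have hsqrt (s : S) : Real.sqrt (σr s ^ 2 + σg s ^ 2) ≤ Real.sqrt 2 * σmax := by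
    rw [← Real.sqrt_sq hσmax, ← Real.sqrt_mul zero_le_two]
    exact Real.sqrt_le_sqrt (by linarith [hσg s, hσr s])
  have hc : 0 ≤ Real.sqrt 2 * σmax * t := by positivity
  have hπb_eq (s : S) : πb s = πr s ∧ Tc s = 0 ∨ πb s = πg s := by
    rcases hTc s with h | h
    · exact .inl ⟨funext fun a => by simp [hπb, h], h⟩
    · exact .inr (funext fun a => by simp [hπb, h])
  have hπb0 (s : S) (a : A) : 0 ≤ πb s a := by
    rcases hπb_eq s with ⟨h, -⟩ | h <;> simp [h, hπr0, hπg0]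
  have hπb1 (s : S) : ∑ a, πb s a = 1 := by
    rcases hπb_eq s with ⟨h, -⟩ | h <;> simp [h, hπr1, hπg1]
  have hadvb (s : S) : Vg s - Real.sqrt 2 * σmax * t ≤ ∑ a, πb s a * Qg s a := by
    rcases hπb_eq s with ⟨h, h0⟩ | h
    · rw [h]
      linarith [hadv s h0, mul_le_mul_of_nonneg_right (hsqrt s) ht0]
    · rw [h, ← hVg s]
      linarith
  simp only [hQg] at hadvb
  simp only [hQb] at hVb
  have hgap := sum_mul_le_of_sum_eq_one hρ0 hρ1
    (value_sub_le_of_advantage_ge hγ0 hγ1 hP0 hP1 hπb0 hπb1 hVb hadvb)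
  simp only [mul_sub, Finset.sum_sub_distrib] at hgap
  linarith
end
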